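/- Let X be a dendrite with E(X) closed, and let Y be a nondegenerate subdendrite of X with E(Y) ∩ E(X)' = ∅. Then Y is a tree (a dendrite with finitely many endpoints) and X \ Y has finitely many connected components. -/

import Mathlib

open Set Metric Filter

/-- A dendrite: a compact, connected, locally connected metric(izable) space
containing no subspace homeomorphic to the circle. -/
def IsDendrite (X : Type*) [TopologicalSpace X] : Prop :=
  CompactSpace X ∧ ConnectedSpace X ∧ LocallyConnectedSpace X ∧
    ∀ s : Set X, ¬ Nonempty (s ≃ₜ (Metric.sphere (0 : ℂ) 1 : Set ℂ))

/-- `A` is an arc from `x` to `y`: the image of an injective continuous map of `[0,1]`. -/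
def IsArc {X : Type*} [TopologicalSpace X] (A : Set X) (x y : X) : Prop :=
  ∃ γ : unitInterval → X, Continuous γ ∧ Function.Injective γ ∧
    γ 0 = x ∧ γ 1 = y ∧ A = Set.range γ

/-- `A` is either the degenerate arc `{x}` (when `x = y`) or an arc from `x` to `y`. -/
def IsArcOrPt {X : Type*} [TopologicalSpace X] (A : Set X) (x y : X) : Prop :=
  (x = y ∧ A = {x}) ∨ IsArc A x y

/-- The convex hull of a set `F` in a dendrite: the intersection of all
subdendrites (i.e. subcontinua) of `X` containing `F`. -/
def dendriteHull {X : Type*} [TopologicalSpace X] (F : Set X) : Set X :=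
  ⋂₀ {D : Set X | F ⊆ D ∧ IsClosed D ∧ IsConnected D}

/-- `x` is an endpoint of the subdendrite `D`: removing it leaves `D` connected,
i.e. `ord(x, D) = 1`. -/
def IsEndpointOf {X : Type*} [TopologicalSpace X] (D : Set X) (x : X) : Prop :=
  x ∈ D ∧ IsConnected (D \ {x})


lemma aux_chain {X : Type*} [MetricSpace X] {C : Set X} (hC : IsPreconnected C) {δ : ℝ} (hδ : 0 < δ)
    {x y : X} (hx : x ∈ C) (hy : y ∈ C) :
    ∃ (N : ℕ) (d : ℕ → X), d 0 = x ∧ (∀ j ≥ N, d j = y) ∧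
      (∀ j, dist (d j) (d (j+1)) < δ) ∧ ∀ j, d j ∈ C := by
  have key : ∀ a ∈ C, ∀ b ∈ C, dist a b < δ → ∃ (N : ℕ) (d : ℕ → X), d 0 = a ∧ (∀ j ≥ N, d j = b) ∧
      (∀ j, dist (d j) (d (j+1)) < δ) ∧ ∀ j, d j ∈ C := by
    intro a ha b hb hab
    refine ⟨1, fun j => if j = 0 then a else b, by simp, fun j hj => ?_, fun j => ?_, fun j => ?_⟩
    · simp; omega
    · by_cases h : j = 0 <;> simp [h, hab, hδ]
    · by_cases h : j = 0 <;> simp [h, ha, hb]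
  refine hC.induction₂' (fun x y => ∃ (N : ℕ) (d : ℕ → X), d 0 = x ∧ (∀ j ≥ N, d j = y) ∧
      (∀ j, dist (d j) (d (j+1)) < δ) ∧ ∀ j, d j ∈ C) ?_ ?_ hx hy
  · intro a ha
    have h1 : ∀ᶠ b in nhdsWithin a C, b ∈ ball a δ :=
      mem_nhdsWithin_of_mem_nhds (ball_mem_nhds a hδ)
    filter_upwards [h1, self_mem_nhdsWithin] with b hb hbC
    exact ⟨key a ha b hbC (by rwa [dist_comm]), key b hbC a ha hb⟩
  · rintro a b c - - - ⟨N, d, h0, hN, hd, hC1⟩ ⟨N', d', h0', hN', hd', hC1'⟩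
    refine ⟨N + N', fun j => if j ≤ N then d j else d' (j - N), by simp [h0], fun j hj => ?_,
      fun j => ?_, fun j => ?_⟩
    · by_cases h : j ≤ N
      · have : j = N := by omega
        subst this
        have : N' = 0 := by omega
        subst this
        simp only [le_refl, if_true]
        rw [hN _ le_rfl, ← h0', hN' 0 le_rfl]
      · simp only [h, if_false]
        exact hN' _ (by omega)
    · by_cases h : j + 1 ≤ N
      · simp only [h, show j ≤ N by omega, if_true]; exact hd j
      · by_cases h2 : j ≤ N
        · have : j = N := by omega
          subst this
          simp only [le_refl, h, if_true, if_false]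
          rw [hN _ le_rfl, ← h0']
          simpa using hd' 0
        · simp only [h, h2, if_false]
          rw [show j + 1 - N = (j - N) + 1 by omega]
          exact hd' _
    · by_cases h : j ≤ N <;> simp [h, hC1, hC1']

lemma aux_ulc {X : Type*} [MetricSpace X] [CompactSpace X] [LocallyConnectedSpace X]
    {ε : ℝ} (hε : 0 < ε) : ∃ δ > 0, δ ≤ ε ∧ ∀ x y : X, dist x y < δ →
      ∃ C : Set X, IsPreconnected C ∧ x ∈ C ∧ y ∈ C ∧ C ⊆ ball x ε := by
  obtain ⟨δ, hδ, h⟩ := lebesgue_number_lemma_of_metric (s := (univ : Set X))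
    (c := fun z => connectedComponentIn (ball z (ε/2)) z) isCompact_univ
    (fun z => isOpen_ball.connectedComponentIn)
    (fun z _ => mem_iUnion.2 ⟨z, mem_connectedComponentIn (mem_ball_self (by positivity))⟩)
  refine ⟨min δ ε, lt_min hδ hε, min_le_right _ _, fun x y hxy => ?_⟩
  obtain ⟨z, hz⟩ := h x (mem_univ _)
  have hx := hz (mem_ball_self hδ)
  refine ⟨_, isPreconnected_connectedComponentIn, hx,
    hz (by rw [mem_ball, dist_comm]; exact hxy.trans_le (min_le_left _ _)), ?_⟩
  intro w hw
  have h1 := connectedComponentIn_subset _ _ hw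
  have h2 := connectedComponentIn_subset _ _ hx
  rw [mem_ball] at *
  linarith [dist_triangle_right w x z]

lemma aux_refine {X : Type*} [MetricSpace X] {ε δ δ' : ℝ} (hδ' : 0 < δ')
    (hD : ∀ x y : X, dist x y < δ →
      ∃ C : Set X, IsPreconnected C ∧ x ∈ C ∧ y ∈ C ∧ C ⊆ ball x ε) (hε : 0 < ε)
    (M : ℕ) (c : ℕ → X) (hc : ∀ i < M, dist (c i) (c (i+1)) < δ) :
    ∃ (N : ℕ) (c' : ℕ → X), 0 < N ∧ c' 0 = c 0 ∧ c' (M * N) = c M ∧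
      (∀ k < M * N, dist (c' k) (c' (k+1)) < δ') ∧ ∀ k ≤ M * N, dist (c' k) (c (k / N)) < ε := by
  have h1 : ∀ i, ∃ (N : ℕ) (d : ℕ → X), d 0 = c i ∧ (i < M → (∀ j ≥ N, d j = c (i+1)) ∧
      (∀ j, dist (d j) (d (j+1)) < δ') ∧ ∀ j, d j ∈ ball (c i) ε) := by
    intro i
    by_cases hi : i < M
    · obtain ⟨C, hC, hx, hy, hCs⟩ := hD _ _ (hc i hi)
      obtain ⟨N, d, a, b, e, f⟩ := aux_chain hC hδ' hx hy
      exact ⟨N, d, a, fun _ => ⟨b, e, fun j => hCs (f j)⟩⟩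
    · exact ⟨0, fun _ => c i, rfl, fun h => absurd h hi⟩
  choose n d hd0 hd using h1
  set N := (Finset.range M).sup n + 1 with hN
  have hNpos : 0 < N := by omega
  have hNle : ∀ i < M, n i ≤ N := fun i hi =>
    (Finset.le_sup (f := n) (Finset.mem_range.2 hi)).trans (Nat.le_succ _)
  refine ⟨N, fun k => d (k / N) (k % N), hNpos, by simp [hd0], ?_, ?_, ?_⟩
  · simp [Nat.mul_div_cancel _ hNpos, hd0]
  · intro k hk
    have hkM : k / N < M := (Nat.div_lt_iff_lt_mul hNpos).2 hk
    obtain ⟨a, b, _⟩ := hd _ hkM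
    by_cases h : k % N + 1 < N
    · have e1 : (k + 1) / N = k / N := by
        rw [Nat.succ_div_of_not_dvd]
        intro hdv
        have := Nat.add_mod k 1 N
        have h3 : (k+1) % N = k % N + 1 := by
          rw [Nat.add_mod, Nat.mod_eq_of_lt (a := 1) (by omega), Nat.mod_eq_of_lt h]
        have := Nat.mod_eq_zero_of_dvd hdv
        omega
      have e2 : (k + 1) % N = k % N + 1 := by
        rw [Nat.add_mod, Nat.mod_eq_of_lt (a := 1) (by omega), Nat.mod_eq_of_lt h]
      simp only [e1, e2]
      exact b _
    · have hlt := Nat.mod_lt k hNpos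
      have h4 : k % N + 1 = N := by omega
      have h5 : k + 1 = (k / N + 1) * N := by
        have := Nat.div_add_mod k N
        rw [add_mul, mul_comm]; omega
      have e1 : (k + 1) / N = k / N + 1 := by rw [h5, Nat.mul_div_cancel _ hNpos]
      have e2 : (k + 1) % N = 0 := by rw [h5]; simp
      simp only [e1, e2, hd0]
      rw [← a N (hNle _ hkM)]
      have := b (k % N)
      rwa [h4] at this
  · intro k hk
    rcases hk.lt_or_eq with hk | hk
    · have hkM : k / N < M := (Nat.div_lt_iff_lt_mul hNpos).2 hk
      exact (hd _ hkM).2.2 _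
    · subst hk
      simp [Nat.mul_div_cancel _ hNpos, hd0, hε]

lemma aux_path {X : Type*} [MetricSpace X] [CompactSpace X] [LocallyConnectedSpace X]
    {ε : ℝ} (hε : 0 < ε) : ∃ δ > 0, ∀ x y : X, dist x y < δ → JoinedIn (ball x ε) x y := by
  set e : ℕ → ℝ := fun n => ε / 8 / 2 ^ n with he
  have hepos : ∀ n, 0 < e n := fun n => by simp only [he]; positivity
  choose D hDpos hDle hD using fun n => aux_ulc (X := X) (hepos n)
  refine ⟨D 0, hDpos 0, fun x y hxy => ?_⟩
  let S : ℕ → Type _ := fun n => {p : ℕ × (ℕ → X) // 0 < p.1 ∧ p.2 0 = x ∧ p.2 p.1 = y ∧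
    ∀ i < p.1, dist (p.2 i) (p.2 (i+1)) < D n}
  have hstep : ∀ n (p : S n), ∃ q : S (n+1), ∃ N > 0, q.1.1 = p.1.1 * N ∧
      ∀ k ≤ q.1.1, dist (q.1.2 k) (p.1.2 (k / N)) < e n := by
    rintro n ⟨⟨M, c⟩, hM, h0, h1, hc⟩
    obtain ⟨N, c', hN, h0', h1', hc', hh⟩ := aux_refine (hDpos (n+1)) (hD n) (hepos n) M c hc
    exact ⟨⟨⟨M * N, c'⟩, Nat.mul_pos hM hN, h0'.trans h0, h1'.trans h1, hc'⟩, N, hN, rfl, hh⟩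
  choose st N hN hM hst using hstep
  let p : ∀ n, S n := fun n => Nat.rec
    ⟨⟨1, fun j => if j = 0 then x else y⟩, one_pos, by simp, by simp, by
      intro i hi
      have : i = 0 := by simpa using hi
      subst this; simpa using hxy⟩ (fun n q => st n q) n
  have hp : ∀ n, p (n+1) = st n (p n) := fun n => rfl
  let f : ℕ → unitInterval → X := fun n t => (p n).1.2 ⌊((p n).1.1 : ℝ) * t⌋₊
  have hfl : ∀ n (t : unitInterval), ⌊((p n).1.1 : ℝ) * t⌋₊ ≤ (p n).1.1 := by
    intro n t
    apply Nat.floor_le_of_le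
    have := t.2.2
    exact mul_le_of_le_one_right (Nat.cast_nonneg _) this
  have hff : ∀ t n, dist (f n t) (f (n+1) t) ≤ ε / 4 / 2 / 2 ^ n := by
    intro t n
    have h1 := hst n (p n) ⌊((p (n+1)).1.1 : ℝ) * t⌋₊ (hfl (n+1) t)
    have h2 : ⌊((p (n+1)).1.1 : ℝ) * t⌋₊ / N n (p n) = ⌊((p n).1.1 : ℝ) * t⌋₊ := by
      rw [← Nat.floor_div_natCast, hp, hM]
      congr 1
      have : (N n (p n) : ℝ) ≠ 0 := by have := hN n (p n); positivity
      push_cast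
      field_simp
    rw [h2] at h1
    rw [dist_comm]
    refine (show dist (f (n+1) t) (f n t) < e n from h1).le.trans (le_of_eq ?_)
    simp only [he]; ring
  have hlim : ∀ t, ∃ F, Tendsto (fun n => f n t) atTop (nhds F) := fun t =>
    cauchySeq_tendsto_of_complete (cauchySeq_of_le_geometric_two (hff t))
  choose F hF using hlim
  have hfF : ∀ n t, dist (f n t) (F t) ≤ ε / 4 / 2 ^ n := fun n t =>
    dist_le_of_le_geometric_two_of_tendsto (hff t) (hF t) n
  have hcont : Continuous F := by
    rw [Metric.continuous_iff]
    intro t η hη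
    obtain ⟨n, hn⟩ : ∃ n : ℕ, ε / 2 ^ n < η := by
      obtain ⟨n, hn⟩ := exists_pow_lt_of_lt_one (div_pos hη hε) (by norm_num : (1/2:ℝ) < 1)
      refine ⟨n, ?_⟩
      rw [lt_div_iff₀ hε] at hn
      calc ε / 2 ^ n = (1/2)^n * ε := by rw [div_pow, one_pow]; ring
        _ < η := hn
    have hMpos := (p n).2.1
    refine ⟨1 / (p n).1.1, by positivity, ?_⟩
    have key : ∀ s t : unitInterval, (s:ℝ) ≤ t → (t:ℝ) - s < 1 / (p n).1.1 →
        dist (f n s) (f n t) < e n := by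
      intro s t hst hts
      have a1 : ⌊((p n).1.1 : ℝ) * s⌋₊ ≤ ⌊((p n).1.1 : ℝ) * t⌋₊ := Nat.floor_mono (by gcongr)
      have a2 : ⌊((p n).1.1 : ℝ) * t⌋₊ ≤ ⌊((p n).1.1 : ℝ) * s⌋₊ + 1 := by
        rw [← Nat.floor_add_one (by have := s.2.1; positivity)]
        apply Nat.floor_mono
        rw [lt_div_iff₀ (by positivity)] at hts
        nlinarith
      rcases a1.eq_or_lt with h | h
      · simp only [f, h, dist_self]; exact hepos n
      · have h3 : ⌊((p n).1.1 : ℝ) * t⌋₊ = ⌊((p n).1.1 : ℝ) * s⌋₊ + 1 := by omega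
        have := (p n).2.2.2.2 ⌊((p n).1.1 : ℝ) * s⌋₊ (by have := hfl n t; omega)
        simp only [f, h3]
        exact this.trans_le (hDle n)
    intro s hs
    have h5 : dist (f n s) (f n t) < e n := by
      rw [Subtype.dist_eq, Real.dist_eq, abs_lt] at hs
      rcases le_total (s:ℝ) t with h | h
      · exact key s t h (by linarith)
      · rw [dist_comm]; exact key t s h (by linarith)
    have h6 : e n = ε / 2^n / 8 := by simp only [he]; ring
    have h7 : ε / 4 / 2^n = ε / 2^n / 4 := by ring
    have h8 := hfF n s
    have h9 := hfF n t
    have : 0 < ε / 2^n := by positivity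
    have := dist_triangle4 (F s) (f n s) (f n t) (F t)
    rw [dist_comm (F s) (f n s)] at this
    linarith
  have hF0 : F 0 = x := by
    refine tendsto_nhds_unique (hF 0) ?_
    have : (fun n => f n 0) = fun _ => x := by
      funext n
      simp [f, (p n).2.2.1]
    rw [this]; exact tendsto_const_nhds
  have hF1 : F 1 = y := by
    refine tendsto_nhds_unique (hF 1) ?_
    have : (fun n => f n 1) = fun _ => y := by
      funext n
      simp [f, (p n).2.2.2.1]
    rw [this]; exact tendsto_const_nhds
  refine ⟨⟨⟨F, hcont⟩, hF0, hF1⟩, fun t => ?_⟩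
  change F t ∈ ball x ε
  have h1 := hfF 0 t
  have h2 : dist (f 0 t) x ≤ ε / 8 := by
    have h3 : D 0 ≤ ε / 8 := by simpa [he] using hDle 0
    have h4 : f 0 t = x ∨ f 0 t = y := by
      simp only [f, p]
      exact ite_eq_or_eq _ _ _
    rcases h4 with h | h <;> rw [h]
    · simp; positivity
    · rw [dist_comm]; linarith
  rw [mem_ball]
  have := dist_triangle_left (F t) x (f 0 t)
  simp at h1
  linarith

lemma aux_joined {X : Type*} [MetricSpace X] [CompactSpace X] [LocallyConnectedSpace X]
    {U : Set X} (hU : IsOpen U) (hUc : IsPreconnected U) {x y : X} (hx : x ∈ U) (hy : y ∈ U) :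
    JoinedIn U x y := by
  refine hUc.induction₂' (JoinedIn U) ?_ (fun _ _ _ _ _ _ h h' => h.trans h') hx hy
  intro a ha
  obtain ⟨ε, hε, hb⟩ := Metric.isOpen_iff.1 hU a ha
  obtain ⟨δ, hδ, h⟩ := aux_path (X := X) hε
  filter_upwards [mem_nhdsWithin_of_mem_nhds (ball_mem_nhds a hδ)] with b hb'
  have := (h a b (by rwa [dist_comm])).mono hb
  exact ⟨this, this.symm⟩


lemma aux_minK {X : Type*} [MetricSpace X] {F : ℝ → X} (hF : Continuous F) :
    ∃ K : Set ℝ, IsClosed K ∧ K ⊆ Icc 0 1 ∧ (0:ℝ) ∈ K ∧ (1:ℝ) ∈ K ∧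
      (∀ a ∈ K, ∀ b ∈ K, a < b → (∀ k ∈ K, a < k → k < b → False) → F a = F b) ∧
      (∀ a ∈ K, ∀ b ∈ K, a < b → F a = F b → (∀ k ∈ K, a < k → k < b → False)) := by
  let S : Set (Set ℝ) := {K | IsClosed K ∧ K ⊆ Icc 0 1 ∧ (0:ℝ) ∈ K ∧ (1:ℝ) ∈ K ∧
      (∀ a ∈ K, ∀ b ∈ K, a < b → (∀ k ∈ K, a < k → k < b → False) → F a = F b)}
  obtain ⟨K, -, hK⟩ := zorn_superset_nonempty S (by
    intro c hc hch hne
    refine ⟨⋂₀ c, ⟨isClosed_sInter fun s hs => (hc hs).1, ?_, ?_, ?_, ?_⟩,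
      fun s hs => sInter_subset_of_mem hs⟩
    · obtain ⟨s, hs⟩ := hne
      exact (sInter_subset_of_mem hs).trans (hc hs).2.1
    · exact mem_sInter.2 fun s hs => (hc hs).2.2.1
    · exact mem_sInter.2 fun s hs => (hc hs).2.2.2.1
    · intro a ha b hb hab hgap
      rw [mem_sInter] at ha hb
      apply eq_of_forall_dist_le
      intro ε hε
      obtain ⟨δ1, hδ1, h1⟩ := Metric.continuous_iff.1 hF a (ε/2) (by positivity)
      obtain ⟨δ2, hδ2, h2⟩ := Metric.continuous_iff.1 hF b (ε/2) (by positivity)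
      obtain ⟨δ, hδ, hd1, hd2, hd3⟩ : ∃ δ > 0, δ < δ1 ∧ δ < δ2 ∧ δ < (b - a) / 2 := by
        refine ⟨min (min δ1 δ2) ((b-a)/2) / 2, ?_, ?_, ?_, ?_⟩
        · have : 0 < b - a := by linarith
          positivity
        all_goals
          have hp : 0 < min (min δ1 δ2) ((b-a)/2) := by
            have : 0 < b - a := by linarith
            positivity
          have q1 := min_le_left (min δ1 δ2) ((b-a)/2)
          have q2 := min_le_right (min δ1 δ2) ((b-a)/2)
          have q3 := min_le_left δ1 δ2
          have q4 := min_le_right δ1 δ2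
          linarith
      have hex : ∃ K ∈ c, K ∩ Icc (a + δ) (b - δ) = ∅ := by
        by_contra hcon
        push Not at hcon
        have : Nonempty c := hne.coe_sort
        have := IsCompact.nonempty_iInter_of_directed_nonempty_isCompact_isClosed
          (fun K : c => (K : Set ℝ) ∩ Icc (a + δ) (b - δ)) ?_ ?_ ?_ ?_
        · obtain ⟨x, hx⟩ := this
          rw [mem_iInter] at hx
          have hxm : x ∈ Icc (a + δ) (b - δ) := (hx (Classical.arbitrary _)).2
          exact hgap x (mem_sInter.2 fun s hs => (hx ⟨s, hs⟩).1) (by linarith [hxm.1])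
            (by linarith [hxm.2])
        · intro s t
          rcases hch.total s.2 t.2 with h | h
          · exact ⟨s, subset_rfl, inter_subset_inter_left _ h⟩
          · exact ⟨t, inter_subset_inter_left _ h, subset_rfl⟩
        · exact fun i => hcon i i.2
        · exact fun i => isCompact_Icc.inter_left (hc i.2).1
        · exact fun i => (hc i.2).1.inter isClosed_Icc
      obtain ⟨K, hKc, hKe⟩ := hex
      have hKcl := (hc hKc).1
      obtain ⟨a', ⟨ha'K, ha'1, ha'2⟩, ha'm⟩ :=
        (isCompact_Icc (a := a) (b := a + δ)).inter_left hKcl |>.exists_isGreatest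
          ⟨a, ha K hKc, le_rfl, by linarith⟩
      obtain ⟨b', ⟨hb'K, hb'1, hb'2⟩, hb'm⟩ :=
        (isCompact_Icc (a := b - δ) (b := b)).inter_left hKcl |>.exists_isLeast
          ⟨b, hb K hKc, by linarith, le_rfl⟩
      have hEq : F a' = F b' := by
        refine (hc hKc).2.2.2.2 a' ha'K b' hb'K (by linarith) fun k hk h1 h2 => ?_
        by_cases q1 : k ≤ a + δ
        · exact absurd (ha'm ⟨hk, by linarith, q1⟩) (not_le.2 h1)
        by_cases q2 : b - δ ≤ k
        · exact absurd (hb'm ⟨hk, q2, by linarith⟩) (not_le.2 h2)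
        push Not at q1 q2
        have : k ∈ K ∩ Icc (a + δ) (b - δ) := ⟨hk, q1.le, q2.le⟩
        rw [hKe] at this
        exact this
      have g1 := h1 a' (by rw [Real.dist_eq, abs_lt]; constructor <;> linarith)
      have g2 := h2 b' (by rw [Real.dist_eq, abs_lt]; constructor <;> linarith)
      rw [hEq] at g1
      linarith [dist_triangle_left (F a) (F b) (F b')]) (Icc 0 1) (by
    refine ⟨isClosed_Icc, subset_rfl, by simp, by simp, fun a ha b hb hab h => ?_⟩
    exact (h ((a+b)/2) ⟨by linarith [ha.1, hb.1], by linarith [ha.2, hb.2]⟩ (by linarith)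
      (by linarith)).elim)
  obtain ⟨h1, h2, h3, h4, h5⟩ := hK.prop
  refine ⟨K, h1, h2, h3, h4, h5, ?_⟩
  intro s hs t ht hst hFst k hk hsk hkt
  have hS : K \ Ioo s t ∈ S := by
    refine ⟨h1.sdiff isOpen_Ioo, sdiff_subset.trans h2, ⟨h3, fun h => ?_⟩, ⟨h4, fun h => ?_⟩, ?_⟩
    · linarith [(h2 hs).1, h.1]
    · linarith [(h2 ht).2, h.2]
    · rintro a ⟨ha, ha'⟩ b ⟨hb, hb'⟩ hab hg
      by_cases hgK : ∀ k ∈ K, a < k → k < b → False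
      · exact h5 a ha b hb hab hgK
      push Not at hgK
      obtain ⟨m, hm, ham, hmb, -⟩ := hgK
      have hmI : m ∈ Ioo s t := by
        by_contra hn
        exact hg m ⟨hm, hn⟩ ham hmb
      have has : a = s := by
        have : a ≤ s := by
          by_contra hn
          exact ha' ⟨not_le.1 hn, ham.trans hmI.2⟩
        rcases this.eq_or_lt with h | h
        · exact h
        · exact (hg s ⟨hs, fun h => lt_irrefl _ h.1⟩ h (hmI.1.trans hmb)).elim
      have hbt : b = t := by
        have : t ≤ b := by
          by_contra hn
          exact hb' ⟨hmI.1.trans hmb, not_le.1 hn⟩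
        rcases this.eq_or_lt with h | h
        · exact h.symm
        · exact (hg t ⟨ht, fun h => lt_irrefl _ h.2⟩ (ham.trans hmI.2) h).elim
      rw [has, hbt, hFst]
  have := hK.le_of_le hS sdiff_subset hk
  exact this.2 ⟨hsk, hkt⟩

lemma aux_size {X : Type*} [MetricSpace X] [CompactSpace X] {F : ℝ → X} (hF : Continuous F)
    {K : Set ℝ} (hK : IsClosed K) (hK1 : K ⊆ Icc 0 1) (h0 : (0:ℝ) ∈ K)
    (hg1 : ∀ a ∈ K, ∀ b ∈ K, a < b → (∀ k ∈ K, a < k → k < b → False) → F a = F b)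
    (hg2 : ∀ a ∈ K, ∀ b ∈ K, a < b → F a = F b → (∀ k ∈ K, a < k → k < b → False)) :
    ∃ Φ : ℝ → ℝ, ContinuousOn Φ K ∧ MonotoneOn Φ K ∧
      ∀ s ∈ K, ∀ t ∈ K, s < t → (Φ s = Φ t ↔ F s = F t) := by
  have : Nonempty X := ⟨F 0⟩
  set z := TopologicalSpace.denseSeq X with hz
  set A : ℝ → Set X := fun x => F '' (K ∩ Iic x) with hA
  have hAne : ∀ x ∈ K, (A x).Nonempty := fun x hx => ⟨F x, x, ⟨hx, mem_Iic.2 le_rfl⟩, rfl⟩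
  have hAmono : ∀ s t, s ≤ t → A s ⊆ A t := fun s t h =>
    image_mono (inter_subset_inter_right _ (Iic_subset_Iic.2 h))
  have hAcl : ∀ x ∈ K, IsClosed (A x) := by
    intro x hx
    refine (IsCompact.image ?_ hF).isClosed
    refine (isCompact_Icc (a := (0:ℝ)) (b := 1)).of_isClosed_subset (hK.inter isClosed_Iic) ?_
    exact inter_subset_left.trans hK1
  set g : ℝ → ℕ → ℝ := fun x n => (1/2)^n * infDist (z n) (A x) with hg
  have hsum : ∀ x ∈ K, Summable (g x) := by
    intro x hx
    refine Summable.of_nonneg_of_le (fun n => by simp only [hg]; positivity [infDist_nonneg (x := z n) (s := A x)]) (fun n => ?_)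
      ((summable_geometric_two).mul_right (diam (univ : Set X)))
    simp only [hg]
    gcongr
    obtain ⟨y, hy⟩ := hAne x hx
    exact (infDist_le_dist_of_mem hy).trans
      (dist_le_diam_of_mem isCompact_univ.isBounded (mem_univ _) (mem_univ _))
  have hganti : ∀ s ∈ K, ∀ t, s ≤ t → ∀ n, g t n ≤ g s n := by
    intro s hs t hst n
    simp only [hg]
    gcongr
    exact infDist_le_infDist_of_subset (hAmono s t hst) (hAne s hs)
  have hmono : ∀ s ∈ K, ∀ t ∈ K, s ≤ t → ∑' n, g t n ≤ ∑' n, g s n := fun s hs t ht hst =>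
    (hsum t ht).tsum_le_tsum (hganti s hs t hst) (hsum s hs)
  refine ⟨fun x => - ∑' n, g x n, ?_, ?_, ?_⟩
  · have huc : UniformContinuousOn F (Icc 0 1) := isCompact_Icc.uniformContinuousOn_of_continuous hF.continuousOn
    rw [Metric.uniformContinuousOn_iff] at huc
    rw [Metric.continuousOn_iff]
    intro b hb ε hε
    obtain ⟨δ, hδ, hh⟩ := huc (ε/4) (by positivity)
    have key : ∀ s ∈ K, ∀ t ∈ K, s ≤ t → t - s < δ → ∑' n, g s n < ∑' n, g t n + ε := by
      intro s hs t ht hst htd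
      have h1 : ∀ n, g s n ≤ g t n + (1/2)^n * (ε/4) := by
        intro n
        simp only [hg]
        rw [← mul_add]
        gcongr
        refine le_of_forall_pos_le_add fun η hη => ?_
        obtain ⟨y, ⟨u, ⟨huK, hut⟩, rfl⟩, hy⟩ := (infDist_lt_iff (hAne t ht)).1
          (lt_add_of_pos_right (infDist (z n) (A t)) hη)
        rcases le_total u s with h | h
        · have := infDist_le_dist_of_mem (x := z n) (show F u ∈ A s from ⟨u, ⟨huK, h⟩, rfl⟩)
          linarith
        · have := infDist_le_dist_of_mem (x := z n) (show F s ∈ A s from ⟨s, ⟨hs, mem_Iic.2 le_rfl⟩, rfl⟩)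
          have h3 := hh u (hK1 huK) s (hK1 hs) (by
            rw [Real.dist_eq, abs_of_nonneg (by linarith)]
            have : u ≤ t := hut
            linarith)
          linarith [dist_triangle (z n) (F u) (F s)]
      have h2 : Summable fun n : ℕ => (1/2:ℝ)^n * (ε/4) := summable_geometric_two.mul_right _
      have h3 := (hsum s hs).tsum_le_tsum h1 ((hsum t ht).add h2)
      rw [(hsum t ht).tsum_add h2, tsum_mul_right, tsum_geometric_two] at h3
      linarith
    refine ⟨δ, hδ, fun a ha hab => ?_⟩
    rw [Real.dist_eq, abs_lt] at hab ⊢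
    rcases le_total a b with h | h
    · have := key a ha b hb h (by linarith)
      have := hmono a ha b hb h
      constructor <;> linarith
    · have := key b hb a ha h (by linarith)
      have := hmono b hb a ha h
      constructor <;> linarith
  · intro s hs t ht hst
    simpa using hmono s hs t ht hst
  · intro s hs t ht hst
    constructor
    · intro hΦ
      by_contra hne
      have hnot : F t ∉ A s := by
        rintro ⟨u, ⟨huK, hus : u ≤ s⟩, hu⟩
        rcases hus.eq_or_lt with h | h
        · exact hne (h ▸ hu)
        · exact hg2 u huK t ht (h.trans hst) hu s hs h hst
      have hpos : 0 < infDist (F t) (A s) :=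
        ((hAcl s hs).notMem_iff_infDist_pos (hAne s hs)).1 hnot
      set r := infDist (F t) (A s) with hr
      obtain ⟨n, hn⟩ : ∃ n, dist (F t) (z n) < r / 3 := by
        have := (TopologicalSpace.denseRange_denseSeq X).exists_dist_lt (F t) (show 0 < r/3 by positivity)
        exact this
      have hlt : g t n < g s n := by
        simp only [hg]
        gcongr
        have q1 := infDist_le_dist_of_mem (x := z n) (show F t ∈ A t from ⟨t, ⟨ht, mem_Iic.2 le_rfl⟩, rfl⟩)
        have q2 : r ≤ infDist (z n) (A s) + dist (F t) (z n) := infDist_le_infDist_add_dist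
        rw [dist_comm] at q1
        linarith
      have := Summable.tsum_lt_tsum (hganti s hs t hst.le) hlt (hsum t ht) (hsum s hs)
      simp only [neg_inj] at hΦ
      linarith
    · intro hFF
      have hAA : A s = A t := by
        refine (hAmono s t hst.le).antisymm ?_
        rintro _ ⟨u, ⟨huK, hut : u ≤ t⟩, rfl⟩
        rcases le_or_gt u s with h | h
        · exact ⟨u, ⟨huK, h⟩, rfl⟩
        · rcases hut.eq_or_lt with h' | h'
          · exact ⟨s, ⟨hs, mem_Iic.2 le_rfl⟩, by rw [hFF, h']⟩
          · exact (hg2 s hs t ht hst hFF u huK h h').elim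
      simp only [hg, hAA]

lemma aux_arc {X : Type*} [MetricSpace X] [CompactSpace X] {F : ℝ → X} (hF : Continuous F)
    (h01 : F 0 ≠ F 1) :
    ∃ γ : unitInterval → X, Continuous γ ∧ Function.Injective γ ∧ γ 0 = F 0 ∧ γ 1 = F 1 ∧
      range γ ⊆ F '' Icc 0 1 := by
  obtain ⟨K, hK, hK1, h0, h1, hg1, hg2⟩ := aux_minK hF
  obtain ⟨Φ, hΦc, hΦm, hΦ⟩ := aux_size hF hK hK1 h0 hg1 hg2
  have hΦ01 : Φ 0 < Φ 1 := lt_of_le_of_ne (hΦm h0 h1 zero_le_one)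
    (fun h => h01 ((hΦ 0 h0 1 h1 zero_lt_one).1 h))
  have hiff : ∀ s ∈ K, ∀ t ∈ K, (Φ s = Φ t ↔ F s = F t) := by
    intro s hs t ht
    rcases lt_trichotomy s t with h | h | h
    · exact hΦ s hs t ht h
    · subst h; simp
    · rw [eq_comm, eq_comm (a := F s)]; exact hΦ t ht s hs h
  have hKc : IsCompact K := isCompact_Icc.of_isClosed_subset hK hK1
  have hsurj : ∀ c ∈ Icc (Φ 0) (Φ 1), ∃ k ∈ K, Φ k = c := by
    intro c hc
    obtain ⟨s, ⟨hsK, hsc : Φ s ≤ c⟩, hsm⟩ := (hKc.of_isClosed_subset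
      (hΦc.preimage_isClosed_of_isClosed hK isClosed_Iic (t := Iic c)) inter_subset_left).exists_isGreatest
      ⟨0, h0, hc.1⟩
    obtain ⟨t, ⟨htK, htc : c ≤ Φ t⟩, htm⟩ := (hKc.of_isClosed_subset
      (hΦc.preimage_isClosed_of_isClosed hK isClosed_Ici (t := Ici c)) inter_subset_left).exists_isLeast
      ⟨1, h1, hc.2⟩
    rcases le_or_gt t s with h | h
    · exact ⟨s, hsK, le_antisymm hsc (htc.trans (hΦm htK hsK h))⟩
    · have := (hΦ s hsK t htK h).2 (hg1 s hsK t htK h fun k hk q1 q2 => by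
        rcases le_total (Φ k) c with h' | h'
        · exact absurd (hsm ⟨hk, h'⟩) (not_le.2 q1)
        · exact absurd (htm ⟨hk, h'⟩) (not_le.2 q2))
      exact ⟨s, hsK, le_antisymm hsc (this ▸ htc)⟩
  have hpos : 0 < Φ 1 - Φ 0 := by linarith
  have hmem : ∀ k : K, (Φ k - Φ 0) / (Φ 1 - Φ 0) ∈ unitInterval := by
    intro k
    have q1 := hΦm h0 k.2 (hK1 k.2).1
    have q2 := hΦm k.2 h1 (hK1 k.2).2
    constructor
    · apply div_nonneg <;> linarith
    · rw [div_le_one hpos]; linarith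
  let ψ : K → unitInterval := fun k => ⟨(Φ k - Φ 0) / (Φ 1 - Φ 0), hmem k⟩
  have hψc : Continuous ψ := by
    refine Continuous.subtype_mk ?_ _
    exact ((continuousOn_iff_continuous_domRestrict.1 hΦc).sub continuous_const).div_const _
  have hψs : Function.Surjective ψ := by
    intro c
    obtain ⟨k, hk, hkc⟩ := hsurj (Φ 0 + c * (Φ 1 - Φ 0))
      ⟨by have := c.2.1; nlinarith, by have := c.2.2; nlinarith⟩
    refine ⟨⟨k, hk⟩, Subtype.ext ?_⟩
    simp only [ψ, hkc]
    field_simp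
    ring
  have hψi : ∀ k l : K, ψ k = ψ l ↔ F k = F l := by
    intro k l
    rw [← hiff k k.2 l l.2, Subtype.ext_iff]
    simp only [ψ]
    rw [div_left_inj' hpos.ne', sub_left_inj]
  have : CompactSpace K := isCompact_iff_compactSpace.1 hKc
  have hq : Topology.IsQuotientMap ψ := hψc.isClosedMap.isQuotientMap hψc hψs
  choose σ hσ using hψs
  have hγ : ∀ k : K, F (σ (ψ k)) = F k := fun k => (hψi _ _).1 (hσ _)
  refine ⟨fun c => F (σ c), ?_, ?_, ?_, ?_, ?_⟩
  · rw [hq.continuous_iff]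
    have : (fun c => F (σ c)) ∘ ψ = fun k : K => F k := funext hγ
    rw [this]
    exact hF.comp continuous_subtype_val
  · intro c c' h
    rw [← hσ c, ← hσ c']
    exact (hψi _ _).2 h
  · have : ψ ⟨0, h0⟩ = 0 := Subtype.ext (by simp [ψ])
    simpa [this] using hγ ⟨0, h0⟩
  · have : ψ ⟨1, h1⟩ = 1 := Subtype.ext (by simp [ψ, div_self hpos.ne'])
    simpa [this] using hγ ⟨1, h1⟩
  · rintro _ ⟨c, rfl⟩
    exact ⟨σ c, hK1 (σ c).2, rfl⟩

lemma aux_arcU {X : Type*} [MetricSpace X] [CompactSpace X] [LocallyConnectedSpace X]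
    {U : Set X} (hU : IsOpen U) (hUc : IsPreconnected U) {x y : X} (hx : x ∈ U) (hy : y ∈ U)
    (hxy : x ≠ y) : ∃ γ : unitInterval → X, Continuous γ ∧ Function.Injective γ ∧ γ 0 = x ∧ γ 1 = y ∧
      range γ ⊆ U := by
  obtain ⟨p, hp⟩ := aux_joined hU hUc hx hy
  obtain ⟨γ, h1, h2, h3, h4, h5⟩ := aux_arc (F := p.extend) p.continuous_extend (by simpa using hxy)
  refine ⟨γ, h1, h2, by simpa using h3, by simpa using h4, h5.trans ?_⟩
  rintro _ ⟨t, ht, rfl⟩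
  rw [Path.extend_apply _ ht]
  exact hp _

lemma aux_circle {X : Type*} [MetricSpace X]
    (hn : ∀ s : Set X, ¬ Nonempty (s ≃ₜ (Metric.sphere (0 : ℂ) 1 : Set ℂ)))
    {α β : unitInterval → X} (hα : Continuous α) (hαi : Function.Injective α)
    (hβ : Continuous β) (hβi : Function.Injective β) (h0 : α 0 = β 0) (h1 : α 1 = β 1) :
    range α ⊆ range β := by
  rintro _ ⟨t, rfl⟩
  by_contra ht
  have hTc : IsClosed (α ⁻¹' range β) := (isCompact_range hβ).isClosed.preimage hα
  obtain ⟨a, ⟨haT, hat : a ≤ t⟩, ham⟩ := (hTc.inter (isClosed_Iic (a := t))).isCompact.exists_isGreatest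
    ⟨0, ⟨0, h0.symm⟩, t.2.1⟩
  obtain ⟨b, ⟨hbT, hbt : t ≤ b⟩, hbm⟩ := (hTc.inter (isClosed_Ici (a := t))).isCompact.exists_isLeast
    ⟨1, ⟨1, h1.symm⟩, t.2.2⟩
  have hat' : a < t := lt_of_le_of_ne hat (fun h => ht (h ▸ haT))
  have hbt' : t < b := lt_of_le_of_ne hbt (fun h => ht (h ▸ hbT))
  have hab : (a:ℝ) < b := hat'.trans hbt'
  obtain ⟨u, hu⟩ := haT
  obtain ⟨v, hv⟩ := hbT
  have huv : (u:ℝ) - v ≠ 0 := by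
    intro h
    have : u = v := Subtype.ext (by linarith)
    rw [this, hv] at hu
    have := hαi hu
    rw [this] at hab
    exact lt_irrefl _ hab
  have hmid : ∀ x : unitInterval, a ≤ x → x ≤ b → α x ∈ range β → x = a ∨ x = b := by
    intro x hax hxb hx
    rcases le_total x t with h | h
    · exact Or.inl (le_antisymm (ham ⟨hx, h⟩) hax)
    · exact Or.inr (le_antisymm hxb (hbm ⟨hx, h⟩))
  let P : ℝ → unitInterval := fun s => projIcc 0 1 zero_le_one (a + s * (b - a))
  let Q : ℝ → unitInterval := fun s => projIcc 0 1 zero_le_one (v + (s - 1) * (u - v))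
  have ha0 := a.2.1
  have hb1 := b.2.2
  have hP : ∀ s, 0 ≤ s → s ≤ 1 → (P s : ℝ) = a + s * (b - a) := by
    intro s hs0 hs1
    simp only [P]
    rw [projIcc_of_mem _ (⟨by nlinarith, by nlinarith⟩ : (a + s * (b - a) : ℝ) ∈ Icc 0 1)]
  have hQ : ∀ s, 1 ≤ s → s ≤ 2 → (Q s : ℝ) = v + (s - 1) * (u - v) := by
    intro s hs0 hs1
    simp only [Q]
    have := u.2.1
    have := u.2.2
    have := v.2.1
    have := v.2.2
    rw [projIcc_of_mem _ (⟨by nlinarith, by nlinarith⟩ : (v + (s - 1) * (u - v) : ℝ) ∈ Icc 0 1)]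
  have hPc : Continuous P := continuous_projIcc.comp (by fun_prop)
  have hQc : Continuous Q := continuous_projIcc.comp (by fun_prop)
  have hP0 : P 0 = a := Subtype.ext (by rw [hP 0 le_rfl zero_le_one]; ring)
  have hP1 : P 1 = b := Subtype.ext (by rw [hP 1 zero_le_one le_rfl]; ring)
  have hQ1 : Q 1 = v := Subtype.ext (by rw [hQ 1 le_rfl (by norm_num)]; ring)
  have hQ2 : Q 2 = u := Subtype.ext (by rw [hQ 2 (by norm_num) le_rfl]; ring)
  let f : ℝ → X := fun s => if s ≤ 1 then α (P s) else β (Q s)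
  have hfc : Continuous f := by
    refine Continuous.if_le (hα.comp hPc) (hβ.comp hQc) continuous_id continuous_const ?_
    rintro s rfl
    rw [hP1, hQ1, hv]
  have hmix : ∀ s s', 0 ≤ s → s ≤ 1 → 1 < s' → s' < 2 → α (P s) = β (Q s') → False := by
    intro s s' hs0 hs1 hs1' hs2 he
    have hPs := hP s hs0 hs1
    have hQs := hQ s' hs1'.le hs2.le
    rcases hmid (P s) (show (a:ℝ) ≤ P s by rw [hPs]; nlinarith)
      (show (P s:ℝ) ≤ b by rw [hPs]; nlinarith) ⟨_, he.symm⟩ with h | h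
    · rw [h, ← hu] at he
      have := hβi he
      rw [← this] at hQs
      have : (s' - 2) * ((u:ℝ) - v) = 0 := by linarith
      rcases mul_eq_zero.1 this with h | h
      · linarith
      · exact huv h
    · rw [h, ← hv] at he
      have := hβi he
      rw [← this] at hQs
      have : (s' - 1) * ((u:ℝ) - v) = 0 := by linarith
      rcases mul_eq_zero.1 this with h | h
      · linarith
      · exact huv h
  have hfi : InjOn f (Ico 0 2) := by
    intro s hs s' hs' he
    simp only [f] at he
    by_cases c : s ≤ 1 <;> by_cases c' : s' ≤ 1
    · simp only [c, c', if_true] at he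
      have := congrArg Subtype.val (hαi he)
      rw [hP s hs.1 c, hP s' hs'.1 c'] at this
      have : (s - s') * ((b:ℝ) - a) = 0 := by linarith
      rcases mul_eq_zero.1 this with h | h <;> linarith
    · simp only [c, c', if_true, if_false] at he
      exact (hmix s s' hs.1 c (not_le.1 c') hs'.2 he).elim
    · simp only [c, c', if_true, if_false] at he
      exact (hmix s' s hs'.1 c' (not_le.1 c) hs.2 he.symm).elim
    · simp only [c, c', if_false] at he
      have := congrArg Subtype.val (hβi he)
      rw [hQ s (not_le.1 c).le hs.2.le, hQ s' (not_le.1 c').le hs'.2.le] at this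
      have : (s - s') * ((u:ℝ) - v) = 0 := by linarith
      rcases mul_eq_zero.1 this with h | h
      · linarith
      · exact (huv h).elim
  have hf02 : f 0 = f (0 + 2) := by
    simp only [f, zero_add, zero_le_one, if_true, show ¬ (2:ℝ) ≤ 1 by norm_num, if_false]
    rw [hP0, hQ2, hu]
  have : Fact ((0:ℝ) < 2) := ⟨by norm_num⟩
  let G : AddCircle (2:ℝ) → X := AddCircle.liftIco 2 0 f
  have hGc : Continuous G := AddCircle.liftIco_continuous hf02 hfc.continuousOn
  have hGi : Function.Injective G := by
    intro x y hxy
    obtain ⟨s, hs, rfl⟩ := AddCircle.eq_coe_Ico x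
    obtain ⟨s', hs', rfl⟩ := AddCircle.eq_coe_Ico y
    simp only [G] at hxy
    rw [AddCircle.liftIco_coe_apply (by simpa using hs), AddCircle.liftIco_coe_apply (by simpa using hs')] at hxy
    rw [hfi hs hs' hxy]
  have hemb := (hGc.isClosedEmbedding hGi).isEmbedding
  refine hn (range G) ⟨hemb.toHomeomorph.symm.trans ?_⟩
  exact (AddCircle.homeomorphCircle (T := 2) (by norm_num)).trans
    (Homeomorph.setCongr (by ext; simp [Submonoid.unitSphere]))

lemma aux_P {X : Type*} [MetricSpace X] [CompactSpace X] [LocallyConnectedSpace X]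
    (hn : ∀ s : Set X, ¬ Nonempty (s ≃ₜ (Metric.sphere (0 : ℂ) 1 : Set ℂ)))
    {Y : Set X} (hY : IsPreconnected Y) {e : X} (he : IsPreconnected (univ \ {e})) :
    IsPreconnected (Y \ {e}) := by
  apply isPreconnected_of_forall_pair
  rintro p ⟨hp, hpe⟩ q ⟨hq, hqe⟩
  by_cases hpq : p = q
  · subst hpq
    exact ⟨{p}, by simpa using ⟨hp, hpe⟩, rfl, rfl, isPreconnected_singleton⟩
  obtain ⟨α, h1, h2, h3, h4, h5⟩ := aux_arcU (isOpen_univ.sdiff isClosed_singleton) he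
    ⟨mem_univ p, hpe⟩ ⟨mem_univ q, hqe⟩ hpq
  refine ⟨range α, ?_, ⟨0, h3⟩, ⟨1, h4⟩, isPreconnected_range h1⟩
  intro x hx
  refine ⟨?_, (h5 hx).2⟩
  by_contra hxY
  have hYs : Y ⊆ connectedComponentIn {x}ᶜ p :=
    hY.subset_connectedComponentIn hp (fun y hy h => hxY (h ▸ hy))
  obtain ⟨β, g1, g2, g3, g4, g5⟩ := aux_arcU (isClosed_singleton.isOpen_compl.connectedComponentIn)
    isPreconnected_connectedComponentIn (hYs hp) (hYs hq) hpq
  have := aux_circle hn h1 h2 g1 g2 (h3.trans g3.symm) (h4.trans g4.symm) hx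
  exact connectedComponentIn_subset _ _ (g5 this) rfl

lemma aux_comp_closure {X : Type*} [TopologicalSpace X] [ConnectedSpace X]
    [LocallyConnectedSpace X] {Y : Set X} (hY : IsClosed Y) (hYne : Y.Nonempty) {x : X}
    (hx : x ∉ Y) : (closure (connectedComponentIn Yᶜ x) ∩ Y).Nonempty := by
  by_contra hcon
  rw [not_nonempty_iff_eq_empty] at hcon
  have hsub : closure (connectedComponentIn Yᶜ x) ⊆ Yᶜ := fun y hy hyY => by
    have : y ∈ closure (connectedComponentIn Yᶜ x) ∩ Y := ⟨hy, hyY⟩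
    rw [hcon] at this; exact this
  have hx' : x ∈ connectedComponentIn Yᶜ x := mem_connectedComponentIn hx
  have h2 : closure (connectedComponentIn Yᶜ x) ⊆ connectedComponentIn Yᶜ x :=
    (isPreconnected_connectedComponentIn.closure).subset_connectedComponentIn
      (subset_closure hx') hsub
  have hcl : IsClopen (connectedComponentIn Yᶜ x) :=
    ⟨closure_subset_iff_isClosed.1 h2, hY.isOpen_compl.connectedComponentIn⟩
  have huniv := hcl.eq_univ ⟨x, hx'⟩
  obtain ⟨y, hy⟩ := hYne
  exact connectedComponentIn_subset Yᶜ x (huniv ▸ mem_univ y) hy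

lemma aux_Q {X : Type*} [MetricSpace X] [CompactSpace X] [ConnectedSpace X]
    [LocallyConnectedSpace X] {Y : Set X} (hY : IsClosed Y) (hYc : IsConnected Y) {x₀ : X}
    (hx₀ : x₀ ∉ Y) : ∃ e ∈ connectedComponentIn Yᶜ x₀, IsConnected ((univ : Set X) \ {e}) := by
  obtain ⟨k, hk⟩ := hYc.nonempty
  set C := connectedComponentIn Yᶜ x₀ with hC
  have hCY : C ⊆ Yᶜ := connectedComponentIn_subset _ _
  let W : X → Set X := fun x => (connectedComponentIn {x}ᶜ k)ᶜ
  have hWself : ∀ x, x ∈ W x := fun x hx => connectedComponentIn_subset _ _ hx rfl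
  have hWcl : ∀ x, IsClosed (W x) := fun x =>
    (isClosed_singleton.isOpen_compl.connectedComponentIn).isClosed_compl
  have hWsub : ∀ x ∈ C, W x ⊆ C := by
    intro x hx y hy
    by_contra hyC
    apply hy
    have hYx : Y ⊆ {x}ᶜ := fun z hz h => hCY hx (h ▸ hz)
    by_cases hyY : y ∈ Y
    · exact hYc.isPreconnected.subset_connectedComponentIn hk hYx hyY
    · obtain ⟨w, hw, hwY⟩ := aux_comp_closure hY hYc.nonempty hyY
      have h1 : IsPreconnected (insert w (connectedComponentIn Yᶜ y)) :=
        isPreconnected_connectedComponentIn.subset_closure (subset_insert _ _)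
          (insert_subset hw subset_closure)
      have h2 := h1.union w (mem_insert _ _) hwY hYc.isPreconnected
      refine h2.subset_connectedComponentIn (Or.inr hk) ?_
        (Or.inl (Or.inr (mem_connectedComponentIn hyY)))
      rintro z ((rfl | hz) | hz)
      · exact hYx hwY
      · rintro (rfl : z = x)
        have e1 := connectedComponentIn_eq hz
        have e2 := connectedComponentIn_eq hx
        apply hyC
        rw [hC, e2, ← e1]
        exact mem_connectedComponentIn hyY
      · exact hYx hz
  have hM : ∀ x ∈ C, ∀ p ∈ W x, p ≠ x → W p ⊆ W x ∧ x ∉ W p := by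
    intro x hx p hp hpx
    have hkx : k ∈ ({x}ᶜ : Set X) := fun h => hCY hx (h ▸ hk)
    have hk' : k ∉ ({x} : Set X) := hkx
    obtain ⟨w, hw, hwx⟩ := aux_comp_closure (isClosed_singleton (x := x)) (singleton_nonempty x) hk'
    rw [mem_singleton_iff] at hwx
    subst hwx
    have h1 : IsPreconnected (insert w (connectedComponentIn {w}ᶜ k)) :=
      isPreconnected_connectedComponentIn.subset_closure (subset_insert _ _)
        (insert_subset hw subset_closure)
    have h2 : insert w (connectedComponentIn {w}ᶜ k) ⊆ connectedComponentIn {p}ᶜ k := by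
      refine h1.subset_connectedComponentIn (Or.inr (mem_connectedComponentIn hkx)) ?_
      rintro z (rfl | hz) (rfl : z = p)
      · exact hpx rfl
      · exact hp hz
    exact ⟨compl_subset_compl.2 ((subset_insert _ _).trans h2), fun h => h (h2 (mem_insert _ _))⟩
  obtain ⟨m, -, hm⟩ := zorn_superset_nonempty (W '' C) (by
    intro c hc hch hne
    have : Nonempty c := hne.coe_sort
    have := IsCompact.nonempty_iInter_of_directed_nonempty_isCompact_isClosed
      (fun K : c => (K : Set X)) ?_ ?_ ?_ ?_
    · obtain ⟨p, hp⟩ := this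
      rw [mem_iInter] at hp
      have hpC : p ∈ C := by
        obtain ⟨s, hs⟩ := hne
        obtain ⟨x, hx, rfl⟩ := hc hs
        exact hWsub x hx (hp ⟨_, hs⟩)
      refine ⟨W p, ⟨p, hpC, rfl⟩, fun s hs => ?_⟩
      obtain ⟨x, hx, rfl⟩ := hc hs
      by_cases hpx : p = x
      · rw [hpx]
      · exact (hM x hx p (hp ⟨_, hs⟩) hpx).1
    · intro s t
      rcases hch.total s.2 t.2 with h | h
      · exact ⟨s, subset_rfl, h⟩
      · exact ⟨t, h, subset_rfl⟩
    · rintro ⟨s, hs⟩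
      obtain ⟨x, hx, rfl⟩ := hc hs
      exact ⟨x, hWself x⟩
    · rintro ⟨s, hs⟩
      obtain ⟨x, hx, rfl⟩ := hc hs
      exact (hWcl x).isCompact
    · rintro ⟨s, hs⟩
      obtain ⟨x, hx, rfl⟩ := hc hs
      exact hWcl x) (W x₀) ⟨x₀, mem_connectedComponentIn hx₀, rfl⟩
  obtain ⟨e, heC, rfl⟩ := hm.prop
  refine ⟨e, heC, ?_⟩
  have hWe : W e ⊆ {e} := by
    intro q hq
    by_contra hqe
    obtain ⟨h1, h2⟩ := hM e heC q hq hqe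
    exact h2 (hm.le_of_le ⟨q, hWsub e heC hq, rfl⟩ h1 (hWself e))
  have hke : k ∈ ({e}ᶜ : Set X) := fun h => hCY heC (h ▸ hk)
  have : (univ : Set X) \ {e} = connectedComponentIn {e}ᶜ k := by
    rw [← compl_eq_univ_sdiff]
    refine (compl_subset_comm.1 hWe).antisymm (connectedComponentIn_subset _ _)
  rw [this]
  exact isConnected_connectedComponentIn_iff.2 hke

lemma aux_bdry {X : Type*} [MetricSpace X] [ConnectedSpace X]
    [LocallyConnectedSpace X] {Y : Set X} {e : X} (heY : e ∈ Y)
    (hYe : IsConnected (Y \ {e})) (heX : ¬ IsConnected ((univ : Set X) \ {e})) :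
    ∃ x ∈ Yᶜ, closure (connectedComponentIn Yᶜ x) ∩ Y = {e} := by
  obtain ⟨k, hkY, hke⟩ := hYe.nonempty
  have hYU : Y \ {e} ⊆ connectedComponentIn {e}ᶜ k :=
    hYe.isPreconnected.subset_connectedComponentIn ⟨hkY, hke⟩ (fun y hy => hy.2)
  obtain ⟨x, hxe, hx⟩ : ∃ x ∈ ({e}ᶜ : Set X), x ∉ connectedComponentIn {e}ᶜ k := by
    by_contra hcon
    push Not at hcon
    apply heX
    rw [← compl_eq_univ_sdiff, (show ({e}ᶜ : Set X) = connectedComponentIn {e}ᶜ k from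
      Subset.antisymm hcon (connectedComponentIn_subset _ _))]
    exact isConnected_connectedComponentIn_iff.2 hke
  have hdisj : connectedComponentIn {e}ᶜ x ⊆ Yᶜ := by
    intro z hz hzY
    have hze := connectedComponentIn_subset _ _ hz
    have e1 := connectedComponentIn_eq hz
    have e2 := connectedComponentIn_eq (hYU ⟨hzY, hze⟩)
    exact hx (e2 ▸ e1 ▸ mem_connectedComponentIn hxe)
  have hxm : x ∈ connectedComponentIn {e}ᶜ x := mem_connectedComponentIn hxe
  have heq : connectedComponentIn Yᶜ x = connectedComponentIn {e}ᶜ x := by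
    apply Subset.antisymm
    · exact connectedComponentIn_mono x (compl_subset_compl.2 (singleton_subset_iff.2 heY))
    · exact isPreconnected_connectedComponentIn.subset_connectedComponentIn hxm hdisj
  refine ⟨x, hdisj hxm, ?_⟩
  rw [heq]
  apply Subset.antisymm
  · rintro y ⟨hy, hyY⟩
    by_contra hye
    have h1 : IsPreconnected (insert y (connectedComponentIn {e}ᶜ x)) :=
      isPreconnected_connectedComponentIn.subset_closure (subset_insert _ _)
        (insert_subset hy subset_closure)
    have h2 := h1.subset_connectedComponentIn (Or.inr hxm)
      (insert_subset hye (connectedComponentIn_subset _ _))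
    exact hdisj (h2 (mem_insert _ _)) hyY
  · obtain ⟨w, hw, hwx⟩ := aux_comp_closure (isClosed_singleton (x := e)) (singleton_nonempty e) hxe
    rw [mem_singleton_iff] at hwx
    subst hwx
    rintro _ rfl
    exact ⟨hw, heY⟩

theorem stmt16 {X : Type*} [MetricSpace X] (hX : IsDendrite X)
    (hEcl : IsClosed {x : X | IsEndpointOf Set.univ x})
    (Y : Set X) (hYcl : IsClosed Y) (hYconn : IsConnected Y) (hYnd : Y.Nontrivial)
    (hEY : {x : X | IsEndpointOf Y x} ∩
        derivedSet {x : X | IsEndpointOf Set.univ x} = ∅) :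
    {x : X | IsEndpointOf Y x}.Finite ∧
      {C : Set X | ∃ x ∈ Yᶜ, C = connectedComponentIn Yᶜ x}.Finite := by
  obtain ⟨hc1, hc2, hc3, hn⟩ := hX
  have hZ : ∀ x ∈ Y, x ∉ derivedSet {x : X | IsEndpointOf Set.univ x} := by
    intro x hxY hx
    have hxE : IsEndpointOf univ x := (isClosed_iff_derivedSet_subset _).1 hEcl hx
    have : x ∈ {x : X | IsEndpointOf Y x} ∩ derivedSet {x : X | IsEndpointOf Set.univ x} := by
      refine ⟨⟨hxY, ?_, aux_P hn hYconn.isPreconnected hxE.2.isPreconnected⟩, hx⟩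
      obtain ⟨y, hy, hyx⟩ := hYnd.exists_ne x
      exact ⟨y, hy, hyx⟩
    rw [hEY] at this
    exact this
  have hcomp : {C : Set X | ∃ x ∈ Yᶜ, C = connectedComponentIn Yᶜ x}.Finite := by
    by_contra hinf
    have hend : ∀ C ∈ {C : Set X | ∃ x ∈ Yᶜ, C = connectedComponentIn Yᶜ x},
        ∃ e ∈ C, IsEndpointOf univ e := by
      rintro _ ⟨x, hx, rfl⟩
      obtain ⟨e, he, h⟩ := aux_Q hYcl hYconn hx
      exact ⟨e, he, mem_univ _, h⟩
    choose! E hE hEe using hend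
    have huniq : ∀ C ∈ {C : Set X | ∃ x ∈ Yᶜ, C = connectedComponentIn Yᶜ x},
        ∀ y ∈ C, C = connectedComponentIn Yᶜ y := by
      rintro _ ⟨x, hx, rfl⟩ y hy
      exact connectedComponentIn_eq hy
    have hinj : InjOn E {C : Set X | ∃ x ∈ Yᶜ, C = connectedComponentIn Yᶜ x} := by
      intro C hC C' hC' h
      rw [huniq C hC _ (hE C hC), huniq C' hC' _ (hE C' hC'), h]
    have hinf' := Set.Infinite.image hinj hinf
    obtain ⟨x, hx⟩ := hinf'.exists_accPt_principal
    have hxd : x ∈ derivedSet {x : X | IsEndpointOf Set.univ x} := by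
      refine AccPt.mono hx (principal_mono.2 ?_)
      rintro _ ⟨C, hC, rfl⟩
      exact hEe C hC
    by_cases hxY : x ∈ Y
    · exact hZ x hxY hxd
    have hop : IsOpen (connectedComponentIn Yᶜ x) := hYcl.isOpen_compl.connectedComponentIn
    have hxm : x ∈ connectedComponentIn Yᶜ x := mem_connectedComponentIn hxY
    have hu : ∀ y ∈ connectedComponentIn Yᶜ x,
        y ∈ E '' {C : Set X | ∃ x ∈ Yᶜ, C = connectedComponentIn Yᶜ x} →
        y = E (connectedComponentIn Yᶜ x) := by
      rintro _ hy ⟨C, hC, rfl⟩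
      rw [connectedComponentIn_eq hy, ← huniq C hC _ (hE C hC)]
    rw [accPt_iff_nhds] at hx
    obtain ⟨y1, ⟨hy1, hy1'⟩, hne1⟩ := hx _ (hop.mem_nhds hxm)
    obtain ⟨y2, ⟨⟨hy2, hne2⟩, hy2'⟩, -⟩ := hx (connectedComponentIn Yᶜ x ∩ {y1}ᶜ)
      (inter_mem (hop.mem_nhds hxm) (isClosed_singleton.isOpen_compl.mem_nhds hne1.symm))
    exact hne2 ((hu y2 hy2 hy2').trans (hu y1 hy1 hy1').symm)
  refine ⟨?_, hcomp⟩
  have h1 : ({x : X | IsEndpointOf Y x} ∩ {x | IsEndpointOf univ x}).Finite := by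
    by_contra hinf
    obtain ⟨x, hx⟩ := Set.Infinite.exists_accPt_principal hinf
    refine hZ x ?_ (AccPt.mono hx (principal_mono.2 inter_subset_right))
    have hxY : AccPt x (principal Y) := AccPt.mono hx (principal_mono.2 fun y hy => hy.1.1)
    exact (isClosed_iff_derivedSet_subset _).1 hYcl hxY
  have h2 : ({x : X | IsEndpointOf Y x} \ {x | IsEndpointOf univ x}).Finite := by
    refine Set.Finite.of_finite_image (f := fun e : X => ({e} : Set X)) ?_
      singleton_injective.injOn
    refine (hcomp.image (fun C => closure C ∩ Y)).subset ?_
    rintro _ ⟨e, ⟨he, heX⟩, rfl⟩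
    obtain ⟨x, hx, h⟩ := aux_bdry he.1 he.2 (fun h => heX ⟨mem_univ _, h⟩)
    exact ⟨_, ⟨x, hx, rfl⟩, h⟩
  exact (h1.union h2).subset fun x hx => by
    by_cases h : IsEndpointOf univ x
    · exact Or.inl ⟨hx, h⟩
    · exact Or.inr ⟨hx, h⟩
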